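/- For every real a > 0 and all reals x ≥ 0, y ≥ 0, the quantity (4a + (a+x) + (a+y) + 2a² + 2a(a+x) + 2a(a+y))·(1+a+x)·(1+a+y+a)·(a+y)·(1+a+x+a) − 6·(a + a(a+x) + a(a+y) − (a+x)(a+y))·(((a+x) + 2a(a+x) − a²)·(a+y)·(1+2a+x) + ((a+y) + 2a(a+y) − a²)·(1+a+x)·(1+a+y)) is nonnegative; equivalently, 4a + b + f + 2a² + 2ab + 2af ≥ 6·(a + ab + af − bf)·((b + 2ab − a²)/((1+b)·(1+a+f)) + (f + 2af − a²)/(f·(1+a+b))) whenever b = a + x and f = a + y with x, y ≥ 0. -/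

import Mathlib

/-- The final inequality in the proof of the hexagon theorem: after the substitutions
`b = a + x`, `f = a + y` with `x, y ≥ 0`, we have
`4a + b + f + 2a² + 2ab + 2af ≥ 6·(a + ab + af − bf)·((b + 2ab − a²)/((1+b)(1+a+f)) +
(f + 2af − a²)/(f(1+a+b)))`. -/
theorem hexagon_final_inequality (a x y b f : ℝ) (ha : 0 < a) (hx : 0 ≤ x) (hy : 0 ≤ y)
    (hb : b = a + x) (hf : f = a + y) :
    6 * (a + a * b + a * f - b * f) *
        ((b + 2 * a * b - a ^ 2) / ((1 + b) * (1 + a + f)) +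
          (f + 2 * a * f - a ^ 2) / (f * (1 + a + b))) ≤
      4 * a + b + f + 2 * a ^ 2 + 2 * a * b + 2 * a * f := by
  subst hb hf
  have hfpos : 0 < a + y := by positivity
  have h₁ : 0 < (1 + (a + x)) * (1 + a + (a + y)) := by positivity
  have h₂ : 0 < (a + y) * (1 + a + (a + x)) := by positivity
  rw [div_add_div _ _ h₁.ne' h₂.ne', ← mul_div_assoc, div_le_iff₀ (mul_pos h₁ h₂), ← sub_nonneg]
  ring_nf
  positivity
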